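/- Let 𝓗 be a complex Hilbert space and let S be a set of bounded linear operators on 𝓗 (the 'boundary operators'). Suppose H : ℝ → B(𝓗) is a family of bounded operators such that for every time t, H(t) lies in the closure of the linear span of S. Let O : ℝ → B(𝓗) be a differentiable family of bounded operators satisfying the Heisenberg equation O'(t) = Complex.I • (H(t) ∘ O(t) − O(t) ∘ H(t)) for all t, and suppose that for every t and every A ∈ S one has O(t) ∘ A = A ∘ O(t). Then O is constant: O(t) = O(0) for all t ∈ ℝ. -/

import Mathlib

/-- An element commuting with every element of a set `S` commutes with every element of the
topological closure of the linear span of `S`. -/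
theorem Commute.of_mem_closure_span {R A : Type*} [CommSemiring R] [Semiring A] [Algebra R A]
    [TopologicalSpace A] [ContinuousMul A] [T2Space A] {S : Set A} {a b : A}
    (ha : ∀ s ∈ S, Commute a s) (hb : b ∈ closure (Submodule.span R S : Set A)) :
    Commute a b := by
  have hclosed : IsClosed {x : A | a * x = x * a} :=
    isClosed_eq (continuous_const.mul continuous_id) (continuous_id.mul continuous_const)
  refine closure_minimal (fun x hx => ?_) hclosed hb
  induction hx using Submodule.span_induction with
  | mem x hx => exact ha x hx
  | zero => exact Commute.zero_right a
  | add x y _ _ hx hy => exact Commute.add_right hx hy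
  | smul r x _ hx => exact Commute.smul_right hx r

/-- If the Hamiltonian `H t` always lies in the operator-norm closure of the linear span of a
set `S` of "boundary" operators, then any observable `O t` evolving by the Heisenberg equation
and commuting with every operator in `S` at every time is constant in time. -/
theorem heisenberg_freeze_out_boundary_hamiltonian
    {𝓗 : Type*} [NormedAddCommGroup 𝓗] [InnerProductSpace ℂ 𝓗] [CompleteSpace 𝓗]
    (S : Set (𝓗 →L[ℂ] 𝓗)) (H : ℝ → (𝓗 →L[ℂ] 𝓗))
    (hH : ∀ t : ℝ, H t ∈ closure (Submodule.span ℂ S : Set (𝓗 →L[ℂ] 𝓗)))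
    (O : ℝ → (𝓗 →L[ℂ] 𝓗))
    (hO : ∀ t : ℝ, HasDerivAt O (Complex.I • (H t ∘L O t - O t ∘L H t)) t)
    (hcomm : ∀ t : ℝ, ∀ A ∈ S, O t ∘L A = A ∘L O t) :
    ∀ t : ℝ, O t = O 0 := by
  have hderiv (t : ℝ) : HasDerivAt O 0 t := by
    have hOH : O t ∘L H t = H t ∘L O t := Commute.of_mem_closure_span (hcomm t) (hH t)
    simpa [hOH] using hO t
  exact fun t => is_const_of_deriv_eq_zero (fun s => (hderiv s).differentiableAt)
    (fun s => (hderiv s).deriv) t 0
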